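/- arXiv:math/0310143 — 9 statements merged into one kernel-verified Lean document; each statement's English description precedes it below -/
import Mathlib

section
/- Let a, b, c be natural numbers with 1 ≤ b ≤ c ≤ a, and assume v is generic. For a natural number k define F(a,b,c,k) = [c]!·[b]!·[a+b−k]! / ([c−k]!·[b−k]!·[k]!·[a+b]!) when k ≤ min(b,c), and F(a,b,c,k) = 0 when k > min(b,c). Then F(a,b,c,0) = 1, and for every k with 1 ≤ k ≤ b, F(a,b,c,k) = F(a,b−1,c,k) + ([a]·[c]/([a+b]·[a+b−1]))·F(a−1,b−1,c−1,k−1). -/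
/-- Quantum integer `[n] = (v^n - v^(-n))/(v - v⁻¹)`. -/
noncomputable def qint {K : Type*} [Field K] (v : K) (n : ℤ) : K :=
  (v ^ n - v ^ (-n)) / (v - v⁻¹)

/-- Quantum factorial `[n]! = [n]·[n-1]⋯[1]`, with `[0]! = 1`. -/
noncomputable def qfact {K : Type*} [Field K] (v : K) : ℕ → K
  | 0 => 1
  | n + 1 => qint v (n + 1) * qfact v n

theorem qint_zero {K : Type*} [Field K] (v : K) : qint v 0 = 0 := by
  simp [qint]

theorem qfact_succ {K : Type*} [Field K] (v : K) (n : ℕ) :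
    qfact v (n + 1) = qint v (n + 1) * qfact v n := rfl

theorem qfact_ne_zero {K : Type*} [Field K] {v : K}
    (hgen : ∀ m : ℤ, 1 ≤ m → qint v m ≠ 0) (n : ℕ) : qfact v n ≠ 0 := by
  induction n with
  | zero => exact one_ne_zero
  | succ n ih => exact mul_ne_zero (hgen _ (by omega)) ih

/-- The three-term identity `[d + k]·[a + d] = [d]·[a + d + k] + [a]·[k]`. -/
theorem qint_add_mul_qint_add {K : Type*} [Field K] {v : K} (hv : v ≠ 0) (a d k : ℤ) :
    qint v (d + k) * qint v (a + d) =
      qint v d * qint v (a + d + k) + qint v a * qint v k := by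
  simp only [qint, div_mul_div_comm, ← add_div]
  congr 1
  simp only [zpow_neg, zpow_add₀ hv]
  have ha := zpow_ne_zero a hv
  have hd := zpow_ne_zero d hv
  have hk := zpow_ne_zero k hv
  field_simp
  ring

theorem stmt4 {K : Type*} [Field K] (v : K) (hv : v ≠ 0) (hvv : v - v⁻¹ ≠ 0)
    (hgen : ∀ m : ℤ, 1 ≤ m → qint v m ≠ 0)
    (a b c : ℕ) (hb : 1 ≤ b) (hbc : b ≤ c) (hca : c ≤ a)
    (F : ℕ → ℕ → ℕ → ℕ → K)
    (hF : ∀ a' b' c' k : ℕ, F a' b' c' k =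
      if k ≤ min b' c' then
        qfact v c' * qfact v b' * qfact v (a' + b' - k) /
          (qfact v (c' - k) * qfact v (b' - k) * qfact v k * qfact v (a' + b'))
      else 0) :
    F a b c 0 = 1 ∧
    ∀ k : ℕ, 1 ≤ k → k ≤ b →
      F a b c k = F a (b - 1) c k +
        (qint v a * qint v c / (qint v (a + b) * qint v (a + b - 1 : ℤ))) *
          F (a - 1) (b - 1) (c - 1) (k - 1) := by
  have hne := qfact_ne_zero hgen
  refine ⟨?_, fun k hk hkb => ?_⟩
  · rw [hF, if_pos (Nat.zero_le _)]
    have hc := hne c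
    have hb' := hne b
    have hab := hne (a + b)
    simp only [Nat.sub_zero, qfact, mul_one]
    exact div_self (by positivity)
  obtain ⟨j, rfl⟩ : ∃ j, k = j + 1 := ⟨k - 1, by omega⟩
  obtain ⟨d, rfl⟩ : ∃ d, b = j + 1 + d := ⟨b - (j + 1), by omega⟩
  obtain ⟨e, rfl⟩ : ∃ e, c = j + 1 + d + e := ⟨c - (j + 1 + d), by omega⟩
  obtain ⟨m, rfl⟩ : ∃ m, a = m + 1 := ⟨a - 1, by omega⟩
  have key := qint_add_mul_qint_add hv (m + 1) d (j + 1)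
  have hj := hgen (j + 1) (by omega)
  have hs := hgen (m + d + j + 2) (by omega)
  have ht := hgen (m + d + j + 1) (by omega)
  have hc := hne (d + e)
  have hd := hne d
  have hjf := hne j
  have hn := hne (m + d + j)
  have hfc : qfact v (j + 1 + d + e) = qint v (j + 1 + d + e) * qfact v (j + d + e) := by
    rw [show j + 1 + d + e = j + d + e + 1 by omega, qfact_succ]
    push_cast
    ring_nf
  have hfb : qfact v (j + 1 + d) = qint v (d + (j + 1)) * qfact v (j + d) := by
    rw [show j + 1 + d = j + d + 1 by omega, qfact_succ]
    push_cast
    ring_nf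
  have hfn : qfact v (m + d + 1) = qint v (m + 1 + d) * qfact v (m + d) := by
    rw [qfact_succ]
    push_cast
    ring_nf
  have hfs : qfact v (m + d + j + 1) = qint v (m + d + j + 1) * qfact v (m + d + j) := by
    rw [qfact_succ]
    push_cast
    rfl
  have hfs' : qfact v (m + d + j + 2) =
      qint v (m + d + j + 2) * (qint v (m + d + j + 1) * qfact v (m + d + j)) := by
    rw [qfact_succ, hfs]
    push_cast
    ring_nf
  rw [show (m + 1 + d + (j + 1) : ℤ) = m + d + j + 2 by ring] at key
  rw [hF (m + 1) (j + 1 + d), if_pos (by omega),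
    hF (m + 1 - 1), if_pos (by omega),
    show j + 1 + d + e - (j + 1) = d + e by omega,
    show j + 1 + d - (j + 1) = d by omega,
    show m + 1 + (j + 1 + d) - (j + 1) = m + d + 1 by omega,
    show m + 1 + (j + 1 + d) = m + d + j + 2 by omega,
    show j + 1 + d + e - 1 = j + d + e by omega,
    show j + 1 + d - 1 = j + d by omega,
    show m + 1 - 1 + (j + d) - (j + 1 - 1) = m + d by omega,
    show m + 1 - 1 + (j + d) = m + d + j by omega,
    show j + d + e - (j + 1 - 1) = d + e by omega,
    show j + d - (j + 1 - 1) = d by omega,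
    show j + 1 - 1 = j by omega,
    show (((m + 1 : ℕ) : ℤ) + ((j + 1 + d : ℕ) : ℤ)) = m + d + j + 2 by push_cast; ring,
    show (m + d + j + 2 - 1 : ℤ) = m + d + j + 1 by ring,
    hfc, hfb, hfn, hfs', qfact_succ v j]
  push_cast
  rcases d with _ | d
  · rw [hF, if_neg (by omega)]
    simp only [Nat.cast_zero, qint_zero] at key
    field_simp
    push_cast
    linear_combination (qint v (j + 1 + 0 + e) * qfact v (j + 0 + e) * qfact v (j + 0) *
      qfact v (m + 0)) * key
  · have hd0 := hgen (d + 1) (by omega)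
    have hdf := hne d
    rw [hF, if_pos (by omega),
      show j + 1 + (d + 1) + e - (j + 1) = d + 1 + e by omega,
      show j + (d + 1) - (j + 1) = d by omega,
      show m + 1 + (j + (d + 1)) - (j + 1) = m + (d + 1) by omega,
      show m + 1 + (j + (d + 1)) = m + (d + 1) + j + 1 by omega,
      hfc, hfs, qfact_succ v j, qfact_succ v d]
    push_cast at *
    field_simp
    linear_combination (qint v (j + 1 + (d + 1) + e) * qfact v (j + (d + 1) + e) *
      qfact v (j + (d + 1)) * qfact v (m + (d + 1))) * key
end

section
/- For natural numbers i, j, k, assume v is generic and define Θ(i,j,k) = (−1)^{i+j+k}·[i+j+k+1]!·[i]!·[j]!·[k]! / ([i+j]!·[j+k]!·[i+k]!). Then: (i) if i+j+k = 1 then Θ(i,j,k) = −[2]; and (ii) for all i ≥ 1 and k ≥ 1, Θ(i,j,k) = −([j+k+1]/[j+k])·Θ(i,j,k−1) + ([i]·[i]/([i+k]·[i+k−1]))·Θ(i−1,j+1,k−1). -/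
theorem qint_one {K : Type*} [Field K] {v : K} (hvv : v - v⁻¹ ≠ 0) : qint v 1 = 1 := by
  simp [qint, div_self hvv]

/-- The Ptolemy relation for quantum integers. -/
theorem qint_mul_qint {K : Type*} [Field K] {v : K} (hv : v ≠ 0) (a b c : ℤ) :
    qint v (a + b + c) * qint v c = qint v (b + c) * qint v (a + c) - qint v a * qint v b := by
  simp only [qint, neg_add, zpow_add₀ hv, zpow_neg]
  have ha := zpow_ne_zero a hv
  have hb := zpow_ne_zero b hv
  have hc := zpow_ne_zero c hv
  rw [div_mul_div_comm, div_mul_div_comm, div_mul_div_comm, ← sub_div]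
  congr 1
  field_simp
  ring

theorem stmt5 {K : Type*} [Field K] (v : K) (hv : v ≠ 0) (hvv : v - v⁻¹ ≠ 0)
    (hgen : ∀ m : ℤ, 1 ≤ m → qint v m ≠ 0)
    (Θ : ℕ → ℕ → ℕ → K)
    (hΘ : ∀ i j k : ℕ, Θ i j k =
      (-1 : K) ^ (i + j + k) *
        (qfact v (i + j + k + 1) * qfact v i * qfact v j * qfact v k) /
        (qfact v (i + j) * qfact v (j + k) * qfact v (i + k))) :
    (∀ i j k : ℕ, i + j + k = 1 → Θ i j k = -qint v 2) ∧
    (∀ i j k : ℕ, 1 ≤ i → 1 ≤ k →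
      Θ i j k =
        -(qint v (j + k + 1 : ℤ) / qint v (j + k : ℤ)) * Θ i j (k - 1) +
          (qint v i * qint v i / (qint v (i + k) * qint v (i + k - 1 : ℤ))) *
            Θ (i - 1) (j + 1) (k - 1)) := by
  refine ⟨fun i j k h => ?_, fun i j k hi hk => ?_⟩
  · obtain ⟨rfl, rfl, rfl⟩ | ⟨rfl, rfl, rfl⟩ | ⟨rfl, rfl, rfl⟩ :
        (i = 1 ∧ j = 0 ∧ k = 0) ∨ (i = 0 ∧ j = 1 ∧ k = 0) ∨ (i = 0 ∧ j = 0 ∧ k = 1) := by omega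
    all_goals simp [hΘ, qfact, qint_one hvv, one_add_one_eq_two]
  · obtain ⟨a, rfl⟩ := Nat.exists_eq_add_of_le' hi
    obtain ⟨c, rfl⟩ := Nat.exists_eq_add_of_le' hk
    have key := qint_mul_qint hv (a + 1) (j + 1) (c + 1)
    have hjc : qint v (j + c + 1) ≠ 0 := hgen _ (by omega)
    have hac₁ : qint v (a + c + 1) ≠ 0 := hgen _ (by omega)
    have hac₂ : qint v (a + c + 2) ≠ 0 := hgen _ (by omega)
    have hf := qfact_ne_zero hgen
    have h₁ := hf (a + j + 1)
    have h₂ := hf (j + c)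
    have h₃ := hf (a + c)
    have e₁ : qfact v (a + 1 + j + (c + 1) + 1) =
        qint v (a + j + c + 3) * qfact v (a + j + c + 2) := by
      rw [show a + 1 + j + (c + 1) + 1 = a + j + c + 2 + 1 by ring, qfact]
      push_cast; ring_nf
    have e₂ : qfact v (j + (c + 1)) = qint v (j + c + 1) * qfact v (j + c) := by
      rw [← add_assoc, qfact]; push_cast; rfl
    have e₃ : qfact v (a + 1 + c) = qint v (a + c + 1) * qfact v (a + c) := by
      rw [add_right_comm, qfact]; push_cast; rfl
    have e₄ : qfact v (a + 1 + (c + 1)) =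
        qint v (a + c + 2) * (qint v (a + c + 1) * qfact v (a + c)) := by
      rw [← add_assoc, qfact, e₃]; push_cast; ring_nf
    simp only [hΘ, Nat.add_sub_cancel]
    rw [e₁, e₂, e₃, e₄, show a + 1 + j + c + 1 = a + j + c + 2 by ring,
      show a + (j + 1) + c + 1 = a + j + c + 2 by ring,
      show a + 1 + j = a + j + 1 by ring, show a + (j + 1) = a + j + 1 by ring,
      show j + 1 + c = j + (c + 1) by ring, e₂]
    have hs (n : ℕ) : qfact v (n + 1) = qint v (n + 1) * qfact v n := rfl
    rw [hs a, hs j, hs c]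
    push_cast
    rw [show (j : ℤ) + (c + 1) + 1 = j + c + 2 by ring, show (j : ℤ) + (c + 1) = j + c + 1 by ring,
      show (a : ℤ) + 1 + (c + 1) - 1 = a + c + 1 by ring,
      show (a : ℤ) + 1 + (c + 1) = a + c + 2 by ring]
    rw [show (a : ℤ) + 1 + (j + 1) + (c + 1) = a + j + c + 3 by ring,
      show (j : ℤ) + 1 + (c + 1) = j + c + 2 by ring,
      show (a : ℤ) + 1 + (c + 1) = a + c + 2 by ring] at key
    field_simp
    linear_combination (-1) ^ (a + j + c) * qfact v (a + j + c + 2) * qint v (a + 1) *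
      qfact v a * qfact v j * qfact v c * key
end

section
/- Let a ≥ 0 and b ≥ 1 be natural numbers and assume v is generic. Define a_{i,j} = ([b−i+1]/[b])·([b+j+1]/[a+b+1]) for 1 ≤ i ≤ b and 0 ≤ j ≤ a. Then: (i) a_{1,a} = 1; (ii) if b ≥ 2 then for all 0 ≤ j ≤ a, a_{b−1,j} = [2]·a_{b,j}; (iii) for all 1 ≤ i ≤ b−2 and 0 ≤ j ≤ a, a_{i,j} − [2]·a_{i+1,j} + a_{i+2,j} = 0; (iv) for all 1 ≤ i ≤ b and 0 ≤ j ≤ a−2, a_{i,j} − [2]·a_{i,j+1} + a_{i,j+2} = 0; and (v) if a ≥ 1 and b ≥ 2 then [3]·a_{1,0} − [2]·a_{1,1} − [2]·a_{2,0} + a_{2,1} = 0. -/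
theorem qint_two {K : Type*} [Field K] {v : K} (hvv : v - v⁻¹ ≠ 0) :
    qint v 2 = v + v⁻¹ := by
  rw [qint, div_eq_iff hvv, zpow_neg, ← inv_zpow]
  norm_cast
  ring

theorem qint_add_two {K : Type*} [Field K] {v : K} (hv : v ≠ 0) (hvv : v - v⁻¹ ≠ 0) (n : ℤ) :
    qint v (n + 2) = qint v 2 * qint v (n + 1) - qint v n := by
  rw [qint_two hvv]
  simp only [qint]
  rw [← mul_div_assoc, ← sub_div]
  congr 1
  simp only [neg_add, zpow_add₀ hv, zpow_neg, zpow_ofNat]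
  field_simp
  ring

theorem stmt6 {K : Type*} [Field K] (v : K) (hv : v ≠ 0) (hvv : v - v⁻¹ ≠ 0)
    (hgen : ∀ m : ℤ, 1 ≤ m → qint v m ≠ 0)
    (a b : ℕ) (hb : 1 ≤ b)
    (A : ℕ → ℕ → K)
    (hA : ∀ i j : ℕ, 1 ≤ i → i ≤ b → j ≤ a →
      A i j = (qint v (b - i + 1 : ℤ) / qint v b) *
        (qint v (b + j + 1 : ℤ) / qint v (a + b + 1 : ℤ))) :
    A 1 a = 1 ∧
    (2 ≤ b → ∀ j : ℕ, j ≤ a → A (b - 1) j = qint v 2 * A b j) ∧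
    (∀ i j : ℕ, 1 ≤ i → i + 2 ≤ b → j ≤ a →
      A i j - qint v 2 * A (i + 1) j + A (i + 2) j = 0) ∧
    (∀ i j : ℕ, 1 ≤ i → i ≤ b → j + 2 ≤ a →
      A i j - qint v 2 * A i (j + 1) + A i (j + 2) = 0) ∧
    (1 ≤ a → 2 ≤ b →
      qint v 3 * A 1 0 - qint v 2 * A 1 1 - qint v 2 * A 2 0 + A 2 1 = 0) := by
  have hrec := qint_add_two hv hvv
  have hb0 : qint v (b : ℤ) ≠ 0 := hgen _ (by omega)
  have hab0 : qint v (a + b + 1 : ℤ) ≠ 0 := hgen _ (by omega)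
  refine ⟨?_, ?_, ?_, ?_, ?_⟩
  · rw [hA 1 a le_rfl hb le_rfl, show (b - (1 : ℕ) + 1 : ℤ) = b by simp,
      show (b + a + 1 : ℤ) = a + b + 1 by ring, div_self hb0, div_self hab0, one_mul]
  · intro hb2 j hj
    rw [hA (b - 1) j (by omega) (by omega) hj, hA b j hb le_rfl hj,
      show (b - (b - 1 : ℕ) + 1 : ℤ) = 2 by omega,
      show (b - b + 1 : ℤ) = 1 by ring, qint_one hvv]
    ring
  · intro i j hi hib hj
    rw [hA i j hi (by omega) hj, hA (i + 1) j (by omega) (by omega) hj,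
      hA (i + 2) j (by omega) hib hj,
      show (b - i + 1 : ℤ) = (b - (i + 2 : ℕ) + 1) + 2 by push_cast; ring,
      show (b - (i + 1 : ℕ) + 1 : ℤ) = (b - (i + 2 : ℕ) + 1) + 1 by push_cast; ring,
      hrec]
    ring
  · intro i j hi hib hj
    rw [hA i j hi hib (by omega), hA i (j + 1) hi hib (by omega), hA i (j + 2) hi hib hj,
      show (b + (j + 1 : ℕ) + 1 : ℤ) = (b + j + 1) + 1 by push_cast; ring,
      show (b + (j + 2 : ℕ) + 1 : ℤ) = (b + j + 1) + 2 by push_cast; ring,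
      hrec]
    ring
  · intro ha hb2
    have h3 : qint v 3 = qint v 2 * qint v 2 - 1 := by
      simpa [qint_one hvv] using hrec 1
    have hsucc : qint v (b + 1 : ℤ) = qint v 2 * qint v b - qint v (b - 1 : ℤ) := by
      have h := hrec (b - 1)
      rwa [show (b - 1 + 2 : ℤ) = b + 1 by ring, sub_add_cancel] at h
    rw [hA 1 0 le_rfl hb (by omega), hA 1 1 le_rfl hb ha, hA 2 0 (by omega) hb2 (by omega),
      hA 2 1 (by omega) hb2 ha,
      show (b - (1 : ℕ) + 1 : ℤ) = b by simp,
      show (b - (2 : ℕ) + 1 : ℤ) = b - 1 by push_cast; ring,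
      show (b + (0 : ℕ) + 1 : ℤ) = b + 1 by simp,
      show (b + (1 : ℕ) + 1 : ℤ) = b + 2 by push_cast; ring,
      hrec b, h3, hsucc]
    ring
end

section
/- Let a ≥ 1 and b ≥ 2 be natural numbers, assume v is generic, and let x ∈ K. Suppose a family a_{i,j} ∈ K (1 ≤ i ≤ b, 0 ≤ j ≤ a) satisfies: a_{b−1,j} = [2]·a_{b,j} for all 0 ≤ j ≤ a; a_{i,j} − [2]·a_{i+1,j} + a_{i+2,j} = 0 for all 1 ≤ i ≤ b−2 and 0 ≤ j ≤ a; a_{i,j} − [2]·a_{i,j+1} + a_{i,j+2} = 0 for all 1 ≤ i ≤ b and 0 ≤ j ≤ a−2; [3]·a_{1,0} − [2]·a_{1,1} − [2]·a_{2,0} + a_{2,1} = 0; and a_{1,0} = x. Then a_{i,j} = ([b−i+1]/[b])·([b+j+1]/[b+1])·x for all 1 ≤ i ≤ b and 0 ≤ j ≤ a. -/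
theorem stmt7 {K : Type*} [Field K] (v : K) (hv : v ≠ 0) (hvv : v - v⁻¹ ≠ 0)
    (hgen : ∀ m : ℤ, 1 ≤ m → qint v m ≠ 0)
    (a b : ℕ) (ha : 1 ≤ a) (hb : 2 ≤ b) (x : K)
    (A : ℕ → ℕ → K)
    (h1 : ∀ j : ℕ, j ≤ a → A (b - 1) j = qint v 2 * A b j)
    (h2 : ∀ i j : ℕ, 1 ≤ i → i + 2 ≤ b → j ≤ a →
      A i j - qint v 2 * A (i + 1) j + A (i + 2) j = 0)
    (h3 : ∀ i j : ℕ, 1 ≤ i → i ≤ b → j + 2 ≤ a →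
      A i j - qint v 2 * A i (j + 1) + A i (j + 2) = 0)
    (h4 : qint v 3 * A 1 0 - qint v 2 * A 1 1 - qint v 2 * A 2 0 + A 2 1 = 0)
    (h5 : A 1 0 = x) :
    ∀ i j : ℕ, 1 ≤ i → i ≤ b → j ≤ a →
      A i j = (qint v (b - i + 1 : ℤ) / qint v b) *
        (qint v (b + j + 1 : ℤ) / qint v (b + 1 : ℤ)) * x := by
  have hrec := qint_add_two hv hvv
  have hrow : ∀ k : ℕ, k + 1 ≤ b → ∀ j ≤ a, A (b - k) j = qint v (k + 1 : ℤ) * A b j := by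
    intro k
    induction k using Nat.twoStepInduction with
    | zero => intro _ j _; simp [qint_one hvv]
    | one => intro _ j hj; simpa [one_add_one_eq_two] using h1 j hj
    | more k ih₀ ih₁ =>
      intro hk j hj
      have h := h2 (b - (k + 2)) j (by omega) (by omega) hj
      rw [show b - (k + 2) + 1 = b - (k + 1) by omega, show b - (k + 2) + 2 = b - k by omega,
        ih₀ (by omega) j hj, ih₁ (by omega) j hj] at h
      have hq := hrec (k + 1)
      push_cast at h ⊢
      rw [show (k + 2 + 1 : ℤ) = k + 1 + 2 by ring, hq]
      linear_combination h
  have hrow' : ∀ i j : ℕ, 1 ≤ i → i ≤ b → j ≤ a →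
      A i j = qint v (b - i + 1 : ℤ) * A b j := by
    intro i j hi hib hj
    have h := hrow (b - i) (by omega) j hj
    rwa [Nat.sub_sub_self hib, Nat.cast_sub hib] at h
  have hb0 : qint v b ≠ 0 := hgen _ (by omega)
  have hb1 : qint v (b + 1 : ℤ) ≠ 0 := hgen _ (by omega)
  have hA1 : ∀ j ≤ a, A 1 j = qint v b * A b j := fun j hj ↦ by
    simpa using hrow' 1 j le_rfl (by omega) hj
  have hA2 : ∀ j ≤ a, A 2 j = qint v (b - 1 : ℤ) * A b j := fun j hj ↦ by
    have h := hrow' 2 j (by omega) hb hj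
    rwa [show ((b : ℤ) - (2 : ℕ) + 1) = b - 1 by push_cast; ring] at h
  have hlast : ∀ j : ℕ, j ≤ a →
      qint v (b + 1 : ℤ) * A b j = qint v (b + j + 1 : ℤ) * A b 0 := by
    intro j
    induction j using Nat.twoStepInduction with
    | zero => intro _; simp
    | one =>
      intro _
      rw [hA1 0 (by omega), hA1 1 ha, hA2 0 (by omega), hA2 1 ha] at h4
      have e1 := hrec (b - 1)
      have e2 := hrec b
      have e3 := hrec 1
      rw [qint_one hvv, one_add_one_eq_two, show (1 + 2 : ℤ) = 3 by norm_num] at e3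
      rw [show (b - 1 + 2 : ℤ) = b + 1 by ring, sub_add_cancel] at e1
      rw [show ((b : ℤ) + (1 : ℕ) + 1) = b + 2 by push_cast; ring, e2, e1]
      rw [e3] at h4
      linear_combination -h4
    | more j ih₀ ih₁ =>
      intro hj
      have h := h3 b j (by omega) le_rfl hj
      have i0 := ih₀ (by omega)
      have i1 := ih₁ (by omega)
      have hq := hrec (b + j + 1)
      push_cast at i1 ⊢
      rw [show (b + (j + 1) + 1 : ℤ) = b + j + 1 + 1 by ring] at i1
      rw [show (b + (j + 2) + 1 : ℤ) = b + j + 1 + 2 by ring, hq]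
      linear_combination qint v (b + 1 : ℤ) * h + qint v 2 * i1 - i0
  intro i j hi hib hj
  rw [hrow' i j hi hib hj, ← h5, hA1 0 (by omega)]
  field_simp
  linear_combination qint v (b - i + 1 : ℤ) * hlast j hj
end

section
/- Let a ≥ 1 and b ≥ 2 be natural numbers and assume v is generic. With a_{i,j} = ([b−i+1]/[b])·([b+j+1]/[a+b+1]), the following hold: (i) a_{2,a} = [b−1]/[b]; and (ii) a_{2,a−1} − [2]·a_{1,a−1} + a_{1,a} = −[a]/([b]·[a+b+1]). -/
/-- The three-term identity `[b-1][a+b] - [2][b][a+b] + [b][a+b+1] = -[a]`. -/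
lemma qint_three_term {K : Type*} [Field K] {v : K} (hv : v ≠ 0) (hvv : v - v⁻¹ ≠ 0) (a b : ℤ) :
    qint v (b - 1) * qint v (a + b) - qint v 2 * (qint v b * qint v (a + b)) +
      qint v b * qint v (a + b + 1) = -qint v a := by
  have hw : v ^ 2 - 1 ≠ 0 := by
    intro h
    apply hvv
    field_simp
    linear_combination h
  have ha : v ^ a ≠ 0 := zpow_ne_zero a hv
  have hb : v ^ b ≠ 0 := zpow_ne_zero b hv
  have hd : v - v⁻¹ = (v ^ 2 - 1) / v := by field_simp
  have h2 : v ^ (2 : ℤ) = v ^ 2 := by norm_cast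
  simp only [qint, zpow_neg, zpow_sub₀ hv, zpow_add₀ hv, zpow_one, h2, hd]
  generalize v ^ a = x at *
  generalize v ^ b = y at *
  field_simp
  ring

theorem stmt8 {K : Type*} [Field K] (v : K) (hv : v ≠ 0) (hvv : v - v⁻¹ ≠ 0)
    (hgen : ∀ m : ℤ, 1 ≤ m → qint v m ≠ 0)
    (a b : ℕ) (ha : 1 ≤ a) (hb : 2 ≤ b)
    (A : ℕ → ℕ → K)
    (hA : ∀ i j : ℕ, 1 ≤ i → i ≤ b → j ≤ a →
      A i j = (qint v (b - i + 1 : ℤ) / qint v b) *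
        (qint v (b + j + 1 : ℤ) / qint v (a + b + 1 : ℤ))) :
    A 2 a = qint v (b - 1 : ℤ) / qint v b ∧
    A 2 (a - 1) - qint v 2 * A 1 (a - 1) + A 1 a =
      -(qint v a / (qint v b * qint v (a + b + 1 : ℤ))) := by
  have hb0 : qint v b ≠ 0 := hgen _ (by omega)
  have hab : qint v (a + b + 1 : ℤ) ≠ 0 := hgen _ (by omega)
  have h2a := hA 2 a (by omega) hb le_rfl
  have h2a' := hA 2 (a - 1) (by omega) hb (by omega)
  have h1a := hA 1 a le_rfl (by omega) le_rfl
  have h1a' := hA 1 (a - 1) le_rfl (by omega) (by omega)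
  rw [show (b - (2 : ℕ) + 1 : ℤ) = b - 1 by push_cast; ring] at h2a h2a'
  rw [show (b - (1 : ℕ) + 1 : ℤ) = b by push_cast; ring] at h1a h1a'
  rw [show (b + a + 1 : ℤ) = a + b + 1 by ring] at h2a h1a
  rw [show (b + (a - 1 : ℕ) + 1 : ℤ) = a + b by omega] at h2a' h1a'
  refine ⟨by rw [h2a, div_self hab, mul_one], ?_⟩
  rw [h2a', h1a', h1a]
  field_simp
  linear_combination qint_three_term hv hvv a b
end

section
/- Let a, b be natural numbers with 1 ≤ b ≤ a and assume v is generic. For a natural number k define F(a,b,k) = (−1)^k·[a]!·[b]!·[a+b+1−k]! / ([a−k]!·[b−k]!·[k]!·[a+b+1]!) when k ≤ b, and F(a,b,k) = 0 when k > b. Then F(a,b,0) = 1, and for every k with 1 ≤ k ≤ b, F(a,b,k) = F(a,b−1,k) − ([a+1]·[a]/([a+b+1]·[a+b]))·F(a−1,b−1,k−1). -/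
theorem qint_mul_qint_add {K : Type*} [Field K] {v : K} (hv : v ≠ 0) (k c n : ℤ) :
    qint v (k + c) * qint v (n + c) =
      qint v c * qint v (n + k + c) + qint v k * qint v n := by
  simp only [qint, div_mul_div_comm, ← add_div]
  congr 1
  simp only [neg_add, zpow_add₀ hv, zpow_neg]
  have hk := zpow_ne_zero k hv
  have hc := zpow_ne_zero c hv
  have hn := zpow_ne_zero n hv
  field_simp
  ring

theorem stmt9 {K : Type*} [Field K] (v : K) (hv : v ≠ 0) (hvv : v - v⁻¹ ≠ 0)
    (hgen : ∀ m : ℤ, 1 ≤ m → qint v m ≠ 0)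
    (a b : ℕ) (hb : 1 ≤ b) (hba : b ≤ a)
    (F : ℕ → ℕ → ℕ → K)
    (hF : ∀ a' b' k : ℕ, F a' b' k =
      if k ≤ b' then
        (-1 : K) ^ k * qfact v a' * qfact v b' * qfact v (a' + b' + 1 - k) /
          (qfact v (a' - k) * qfact v (b' - k) * qfact v k * qfact v (a' + b' + 1))
      else 0) :
    F a b 0 = 1 ∧
    ∀ k : ℕ, 1 ≤ k → k ≤ b →
      F a b k = F a (b - 1) k -
        (qint v (a + 1 : ℤ) * qint v a /
          (qint v (a + b + 1 : ℤ) * qint v (a + b))) *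
          F (a - 1) (b - 1) (k - 1) := by
  have hf := qfact_ne_zero hgen
  refine ⟨?_, ?_⟩
  · rw [hF, if_pos (Nat.zero_le b)]
    have h0 : qfact v 0 = 1 := rfl
    simp only [pow_zero, Nat.sub_zero, h0, one_mul, mul_one]
    exact div_self (mul_ne_zero (mul_ne_zero (hf _) (hf _)) (hf _))
  · rintro k hk hkb
    obtain ⟨j, rfl⟩ := Nat.exists_eq_add_of_le' hk
    obtain ⟨c, rfl⟩ := Nat.exists_eq_add_of_le' hkb
    obtain ⟨d, rfl⟩ := Nat.exists_eq_add_of_le' (hkb.trans hba)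
    have key := qint_mul_qint_add hv (j + 1) c (d + j + 2)
    have ha : qfact v (d + (j + 1)) = qint v (d + j + 1) * qfact v (d + j) := by
      rw [← add_assoc, qfact_succ]; push_cast; rfl
    have hb' : qfact v (c + (j + 1)) = qint v (j + 1 + c) * qfact v (c + j) := by
      rw [← add_assoc, qfact_succ]; push_cast; ring_nf
    have hm : qfact v (d + j + c + 2) =
        qint v (d + j + 2 + c) * qfact v (d + j + c + 1) := by
      rw [qfact_succ]; push_cast; ring_nf
    have ht : qfact v (d + j + c + j + 2) =
        qint v (d + j + c + j + 2) * qfact v (d + j + c + j + 1) := by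
      rw [qfact_succ]; push_cast; ring_nf
    have ht' : qfact v (d + j + c + j + 3) =
        qint v (d + j + 2 + (j + 1) + c) * qfact v (d + j + c + j + 2) := by
      rw [qfact_succ]; push_cast; ring_nf
    have n1 : qint v (d + j + c + j + 2) ≠ 0 := hgen _ (by lia)
    have n2 : qint v (d + j + 2 + (j + 1) + c) ≠ 0 := hgen _ (by lia)
    have n3 : qint v (j + 1) ≠ 0 := hgen _ (by lia)
    have z1 : ((d + (j + 1) : ℕ) + 1 : ℤ) = d + j + 2 := by push_cast; ring
    have z2 : ((d + (j + 1) : ℕ) : ℤ) = d + j + 1 := by push_cast; ring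
    have z3 : ((d + (j + 1) : ℕ) + (c + (j + 1) : ℕ) + 1 : ℤ) =
        d + j + 2 + (j + 1) + c := by push_cast; ring
    have z4 : ((d + (j + 1) : ℕ) + (c + (j + 1) : ℕ) : ℤ) = d + j + c + j + 2 := by
      push_cast; ring
    have h1 : F (d + (j + 1)) (c + (j + 1)) (j + 1) =
        (-1) ^ (j + 1) * qfact v (d + (j + 1)) * qfact v (c + (j + 1)) *
          qfact v (d + j + c + 2) /
          (qfact v d * qfact v c * qfact v (j + 1) * qfact v (d + j + c + j + 3)) := by
      have e1 : d + (j + 1) + (c + (j + 1)) + 1 - (j + 1) = d + j + c + 2 := by lia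
      have e2 : d + (j + 1) + (c + (j + 1)) + 1 = d + j + c + j + 3 := by lia
      rw [hF, if_pos hkb, e1, e2, Nat.add_sub_cancel, Nat.add_sub_cancel]
    have h2 : F (d + (j + 1)) (c + (j + 1) - 1) (j + 1) =
        (-1) ^ (j + 1) * qfact v (d + (j + 1)) * qfact v (c + j) *
          qfact v (d + j + c + 1) * qint v c /
          (qfact v d * qfact v c * qfact v (j + 1) * qfact v (d + j + c + j + 2)) := by
      rw [hF]
      cases c with
      | zero => simp [qint]
      | succ c =>
        have e1 : d + (j + 1) + (c + 1 + (j + 1) - 1) + 1 - (j + 1) =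
          d + j + (c + 1) + 1 := by lia
        have e2 : d + (j + 1) + (c + 1 + (j + 1) - 1) + 1 =
          d + j + (c + 1) + j + 2 := by lia
        have e3 : d + (j + 1) - (j + 1) = d := by lia
        have e4 : c + 1 + (j + 1) - 1 - (j + 1) = c := by lia
        have e5 : c + 1 + (j + 1) - 1 = c + 1 + j := by lia
        rw [if_pos (by lia), e1, e2, e3, e4, e5, qfact_succ v c]
        have n4 : qint v (c + 1) ≠ 0 := hgen _ (by lia)
        push_cast
        field_simp [hf]
    have h3 : F (d + (j + 1) - 1) (c + (j + 1) - 1) (j + 1 - 1) =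
        (-1) ^ j * qfact v (d + j) * qfact v (c + j) * qfact v (d + j + c + 1) /
          (qfact v d * qfact v c * qfact v j * qfact v (d + j + c + j + 1)) := by
      have e1 : d + (j + 1) - 1 = d + j := by lia
      have e2 : c + (j + 1) - 1 = c + j := by lia
      have e3 : d + j + (c + j) + 1 - j = d + j + c + 1 := by lia
      have e4 : d + j + (c + j) + 1 = d + j + c + j + 1 := by lia
      rw [hF, e1, e2, Nat.add_sub_cancel, if_pos (by lia), e3, e4,
        Nat.add_sub_cancel, Nat.add_sub_cancel]
    rw [h1, h2, h3, z3, z4, z1, z2, ht', ht, ha, hb', hm, qfact_succ v j]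
    have f1 := hf d
    have f2 := hf c
    have f3 := hf j
    have f4 := hf (d + j + c + j + 1)
    rw [pow_succ]
    field_simp
    linear_combination -(qint v (d + j + 1) * qfact v (d + j) * qfact v (c + j) *
      qfact v (d + j + c + 1)) * key
end

section
/- For natural numbers i, j, k, assume v is generic and define G(i,j,k) = (−1)^j·[i+j+k+1]!·[i]!·[j]!·[k]! / ([i+j]!·[j+k]!·[i+k+1]!). Then: (i) G(i,j,0) = (−1)^j·[i+j+1]/[i+1]; and (ii) for all j ≥ 1 and k ≥ 1, G(i,j,k) = G(i,j,k−1) + ([j]·[j]/([j+k]·[j+k−1]))·G(i+1,j−1,k−1). -/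
theorem qint_mul_qint_sub {K : Type*} [Field K] {v : K} (hv : v ≠ 0) (a b c : ℤ) :
    qint v (a + b + c) * qint v c = qint v (a + c) * qint v (b + c) - qint v a * qint v b := by
  have ha : v ^ a ≠ 0 := zpow_ne_zero _ hv
  have hb : v ^ b ≠ 0 := zpow_ne_zero _ hv
  have hc : v ^ c ≠ 0 := zpow_ne_zero _ hv
  simp only [qint, div_mul_div_comm, ← sub_div, zpow_neg, zpow_add₀ hv]
  congr 1
  field_simp
  ring

theorem stmt14 {K : Type*} [Field K] (v : K) (hv : v ≠ 0) (hvv : v - v⁻¹ ≠ 0)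
    (hgen : ∀ m : ℤ, 1 ≤ m → qint v m ≠ 0)
    (G : ℕ → ℕ → ℕ → K)
    (hG : ∀ i j k : ℕ, G i j k =
      (-1 : K) ^ j *
        (qfact v (i + j + k + 1) * qfact v i * qfact v j * qfact v k) /
        (qfact v (i + j) * qfact v (j + k) * qfact v (i + k + 1))) :
    (∀ i j : ℕ, G i j 0 = (-1 : K) ^ j * (qint v (i + j + 1 : ℤ) / qint v (i + 1 : ℤ))) ∧
    (∀ i j k : ℕ, 1 ≤ j → 1 ≤ k →
      G i j k = G i j (k - 1) +
        (qint v j * qint v j / (qint v (j + k : ℤ) * qint v (j + k - 1 : ℤ))) *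
          G (i + 1) (j - 1) (k - 1)) := by
  have hf := qfact_ne_zero hgen
  refine ⟨fun i j => ?_, fun i j k hj hk => ?_⟩
  · have hi := hgen (i + 1) (by lia)
    have h₁ := hf i
    have h₂ := hf j
    have h₃ := hf (i + j)
    have h₀ : qfact v 0 = 1 := rfl
    simp only [hG, add_zero, qfact_succ, h₀]
    push_cast
    field_simp
  · obtain ⟨a, rfl⟩ := Nat.exists_eq_add_of_le' hj
    obtain ⟨b, rfl⟩ := Nat.exists_eq_add_of_le' hk
    have key := qint_mul_qint_sub hv (a + 1) (i + 1) (b + 1)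
    have h₁ := hf (i + a + 1)
    have h₂ := hf (a + b)
    have h₃ := hf (i + b + 1)
    have e₁ := hgen (a + b + 1) (by lia)
    have e₂ := hgen (a + b + 1 + 1) (by lia)
    have e₃ := hgen (i + b + 1 + 1) (by lia)
    rw [hG, hG, hG, Nat.add_sub_cancel, Nat.add_sub_cancel,
      show i + (a + 1) + (b + 1) + 1 = i + a + b + 1 + 1 + 1 by lia,
      show i + (a + 1) + b + 1 = i + a + b + 1 + 1 by lia,
      show i + 1 + a + b + 1 = i + a + b + 1 + 1 by lia,
      show i + (a + 1) = i + a + 1 by lia,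
      show i + 1 + a = i + a + 1 by lia,
      show a + 1 + (b + 1) = a + b + 1 + 1 by lia,
      show a + 1 + b = a + b + 1 by lia,
      show i + (b + 1) + 1 = i + b + 1 + 1 by lia,
      show i + 1 + b + 1 = i + b + 1 + 1 by lia,
      qfact_succ v (i + a + b + 1 + 1), qfact_succ v i, qfact_succ v a, qfact_succ v b,
      qfact_succ v (a + b + 1), qfact_succ v (a + b), qfact_succ v (i + b + 1), pow_succ]
    push_cast
    rw [show (a + 1 + (i + 1) + (b + 1) : ℤ) = i + a + b + 1 + 1 + 1 by ring,
      show (a + 1 + (b + 1) : ℤ) = a + b + 1 + 1 by ring,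
      show (i + 1 + (b + 1) : ℤ) = i + b + 1 + 1 by ring] at key
    rw [show (a + 1 + (b + 1) : ℤ) = a + b + 1 + 1 by ring,
      show (a + b + 1 + 1 - 1 : ℤ) = a + b + 1 by ring]
    field_simp
    linear_combination -(qfact v (i + a + b + 1 + 1) * qfact v i * qint v (a + 1) * qfact v a *
      qfact v b) * key
end

section
/- Assume v is generic. Then the pair (c,d) = ([2], 1) is the unique pair of elements of K satisfying the two equations [3]·[3] = [4]·c + d and [2]·[3] = c + [4]·d. -/
/-- A quantum integer can be computed from any factorization of `v ^ n - v ^ (-n)`. -/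
lemma qint_eq_of_mul_eq {K : Type*} [Field K] {v a : K} (hvv : v - v⁻¹ ≠ 0) (n : ℕ)
    (h : a * (v - v⁻¹) = v ^ n - v⁻¹ ^ n) : qint v n = a := by
  rw [qint, div_eq_iff hvv, h, zpow_neg, zpow_natCast, inv_pow]

theorem stmt15 {K : Type*} [Field K] (v : K) (hv : v ≠ 0) (hvv : v - v⁻¹ ≠ 0)
    (hgen : ∀ m : ℤ, 1 ≤ m → qint v m ≠ 0) :
    (qint v 3 * qint v 3 = qint v 4 * qint v 2 + 1 ∧
      qint v 2 * qint v 3 = qint v 2 + qint v 4 * 1) ∧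
    ∀ c d : K,
      qint v 3 * qint v 3 = qint v 4 * c + d →
      qint v 2 * qint v 3 = c + qint v 4 * d →
      c = qint v 2 ∧ d = 1 := by
  have hw : v * v⁻¹ = 1 := mul_inv_cancel₀ hv
  have h2 : qint v 2 = v + v⁻¹ := qint_eq_of_mul_eq hvv 2 (by ring)
  have h3 : qint v 3 = v ^ 2 + 1 + v⁻¹ ^ 2 :=
    qint_eq_of_mul_eq hvv 3 (by linear_combination (v⁻¹ - v) * hw)
  have h4 : qint v 4 = v ^ 3 + v + v⁻¹ + v⁻¹ ^ 3 :=
    qint_eq_of_mul_eq hvv 4 (by linear_combination (v⁻¹ ^ 2 - v ^ 2) * hw)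
  have h5 : qint v 5 = v ^ 4 + v ^ 2 + 1 + v⁻¹ ^ 2 + v⁻¹ ^ 4 :=
    qint_eq_of_mul_eq hvv 5 (by
      linear_combination (v⁻¹ ^ 3 - v ^ 3 + v⁻¹ - v) * hw)
  have e1 : qint v 3 * qint v 3 = qint v 4 * qint v 2 + 1 := by
    rw [h2, h3, h4]; field_simp; ring
  have e2 : qint v 2 * qint v 3 = qint v 2 + qint v 4 * 1 := by
    rw [h2, h3, h4]; field_simp; ring
  have e3 : qint v 4 ^ 2 - 1 = qint v 5 * qint v 3 := by
    rw [h3, h4, h5]; field_simp; ring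
  refine ⟨⟨e1, e2⟩, fun c d hc hd => ?_⟩
  have hdet : qint v 5 * qint v 3 ≠ 0 :=
    mul_ne_zero (hgen 5 (by norm_num)) (hgen 3 (by norm_num))
  constructor
  · refine mul_left_cancel₀ hdet ?_
    rw [← e3]
    linear_combination qint v 4 * (e1 - hc) - (e2 - hd)
  · refine mul_left_cancel₀ hdet ?_
    rw [← e3]
    linear_combination qint v 4 * (e2 - hd) - (e1 - hc)
end

section
/- Assume v is generic. Then (g,h,i) = (1, 0, 0) is the unique triple of elements of K satisfying the four equations: [2][3] = [2][3]·g + h + ([4][3]/[2])·i; [2][3] = [2][3]·g + ([4][3]/[2])·h + i; [2] = [2]·g + [3]·h; and [2] = [2]·g + i. -/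
theorem qint_four {K : Type*} [Field K] {v : K} (hv : v ≠ 0) :
    qint v 4 = (v ^ 2 + (v⁻¹) ^ 2) * qint v 2 := by
  simp only [qint, zpow_neg]
  norm_cast
  field_simp
  ring

theorem qint_three {K : Type*} [Field K] {v : K} (hv : v ≠ 0) (hvv : v - v⁻¹ ≠ 0) :
    qint v 3 = v ^ 2 + (v⁻¹) ^ 2 + 1 := by
  rw [qint, div_eq_iff hvv, zpow_neg]
  norm_cast
  field_simp
  ring

theorem qint_five {K : Type*} [Field K] {v : K} (hv : v ≠ 0) (hvv : v - v⁻¹ ≠ 0) :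
    qint v 5 = (v ^ 2 + (v⁻¹) ^ 2) ^ 2 + (v ^ 2 + (v⁻¹) ^ 2) - 1 := by
  rw [qint, div_eq_iff hvv, zpow_neg]
  norm_cast
  field_simp
  ring

theorem stmt16 {K : Type*} [Field K] (v : K) (hv : v ≠ 0) (hvv : v - v⁻¹ ≠ 0)
    (hgen : ∀ m : ℤ, 1 ≤ m → qint v m ≠ 0) :
    (qint v 2 * qint v 3 = qint v 2 * qint v 3 * 1 + 0 + (qint v 4 * qint v 3 / qint v 2) * 0 ∧
      qint v 2 * qint v 3 = qint v 2 * qint v 3 * 1 + (qint v 4 * qint v 3 / qint v 2) * 0 + 0 ∧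
      qint v 2 = qint v 2 * 1 + qint v 3 * 0 ∧
      qint v 2 = qint v 2 * 1 + 0) ∧
    ∀ g h i : K,
      qint v 2 * qint v 3 = qint v 2 * qint v 3 * g + h + (qint v 4 * qint v 3 / qint v 2) * i →
      qint v 2 * qint v 3 = qint v 2 * qint v 3 * g + (qint v 4 * qint v 3 / qint v 2) * h + i →
      qint v 2 = qint v 2 * g + qint v 3 * h →
      qint v 2 = qint v 2 * g + i →
      g = 1 ∧ h = 0 ∧ i = 0 := by
  refine ⟨by simp, fun g h i h₁ _ h₃ h₄ => ?_⟩
  have n2 := hgen 2 (by norm_num)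
  have n4 := hgen 4 (by norm_num)
  have n5 := hgen 5 (by norm_num)
  have e3 := qint_three hv hvv
  have e4 := qint_four hv
  have e5 := qint_five hv hvv
  set c := v ^ 2 + (v⁻¹) ^ 2
  have hc : c ≠ 0 := fun hc => n4 (by rw [e4, hc, zero_mul])
  have hi : i = qint v 3 * h := by linear_combination h₃ - h₄
  have hq : qint v 4 * qint v 3 / qint v 2 = c * qint v 3 := by
    rw [e4]
    field_simp
  have key : c * qint v 5 * h = 0 := by
    rw [hq, hi] at h₁
    rw [e5]
    rw [e3] at h₁ h₃
    linear_combination (c + 1) * h₃ - h₁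
  have hh : h = 0 := (mul_eq_zero.mp key).resolve_left (mul_ne_zero hc n5)
  refine ⟨mul_left_cancel₀ n2 ?_, hh, by rw [hi, hh, mul_zero]⟩
  rw [hh] at h₃
  linear_combination -h₃
end
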